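/- Let Z be a standard Gaussian random variable, μ ∈ ℝ, σ > 0, and set P = exp(μ + σZ) (the one-step collateral price ratio p_{t+1}/p_t). Let 0 < c ≤ LT < 1 be the collateral factor and the liquidation threshold, and consider a borrower at the maximum allowed loan-to-value c, with zero liquidation incentive, whose per-unit-debt liquidation amount is max{0, (1 − (LT/c)·P)}/(1 − LT). Then E[ max{0, 1 − (LT/c)·P} / (1 − LT) ] = (1/(1 − LT)) · ( Φ((ln(c/LT) − μ)/σ) − (LT/c)·exp(μ + σ²/2)·Φ((ln(c/LT) − μ − σ²)/σ) ), where Φ denotes the standard normal cumulative distribution function. -/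

import Mathlib

open MeasureTheory ProbabilityTheory Real

/-- The standard normal cumulative distribution function. -/
noncomputable def stdNormalCDF (x : ℝ) : ℝ :=
  (gaussianReal 0 1 (Set.Iic x)).toReal

/-- Exponential tilting: `exp (s * x)` moves the mean of the standard Gaussian to `s`. -/
theorem setIntegral_Iic_exp_mul_gaussianReal (s d : ℝ) :
    ∫ x in Set.Iic d, Real.exp (s * x) ∂gaussianReal 0 1
      = Real.exp (s ^ 2 / 2) * stdNormalCDF (d - s) := by
  have hshift : stdNormalCDF (d - s) = ∫ x in Set.Iic d, gaussianPDFReal s 1 x := by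
    have hmap := gaussianReal_map_add_const (μ := 0) (v := 1) s
    rw [zero_add] at hmap
    have hpre : (fun x : ℝ => x + s) ⁻¹' Set.Iic d = Set.Iic (d - s) := by
      ext x
      simp [le_sub_iff_add_le]
    rw [stdNormalCDF, ← hpre, ← Measure.map_apply (measurable_add_const s) measurableSet_Iic,
      hmap, gaussianReal_apply_eq_integral s one_ne_zero, ENNReal.toReal_ofReal]
    exact integral_nonneg fun x => gaussianPDFReal_nonneg s 1 x
  rw [hshift, ← integral_const_mul, ← integral_indicator measurableSet_Iic,
    integral_gaussianReal_eq_integral_smul one_ne_zero, ← integral_indicator measurableSet_Iic]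
  congr 1 with x
  by_cases hx : x ∈ Set.Iic d
  · simp only [Set.indicator_of_mem hx, gaussianPDFReal, smul_eq_mul]
    rw [mul_assoc, mul_left_comm (Real.exp (s ^ 2 / 2)), ← Real.exp_add, ← Real.exp_add]
    congr 2
    push_cast
    ring
  · simp [Set.indicator_of_notMem hx]

/-- Lemma 3.3 (liquidation part): the expected per-unit-debt liquidation amount of
a borrower at the maximum loan-to-value `c ≤ LT` with zero liquidation incentive,
when the price ratio is lognormal `P = exp(μ + σZ)`. -/
theorem stmt_5 {Ω : Type*} [MeasurableSpace Ω] (P : Measure Ω) [IsProbabilityMeasure P]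
    (Z : Ω → ℝ) (hZ : Measurable Z) (hlaw : P.map Z = gaussianReal 0 1)
    (μ σ : ℝ) (hσ : 0 < σ)
    (c LT : ℝ) (hc : 0 < c) (hcLT : c ≤ LT) (hLT : LT < 1) :
    ∫ ω, max 0 (1 - LT / c * Real.exp (μ + σ * Z ω)) / (1 - LT) ∂P
      = (1 / (1 - LT)) *
        (stdNormalCDF ((Real.log (c / LT) - μ) / σ)
          - LT / c * Real.exp (μ + σ ^ 2 / 2) *
              stdNormalCDF ((Real.log (c / LT) - μ - σ ^ 2) / σ)) := by
  have hL : 0 < LT := hc.trans_le hcLT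
  set d := (Real.log (c / LT) - μ) / σ with hd
  have hd' : (Real.log (c / LT) - μ - σ ^ 2) / σ = d - σ := by
    rw [hd]
    field_simp
  have hexercise (x : ℝ) : LT / c * Real.exp (μ + σ * x) ≤ 1 ↔ x ≤ d := by
    rw [hd, le_div_iff₀ hσ, le_sub_iff_add_le, Real.le_log_iff_exp_le (by positivity),
      ← le_div_iff₀' (by positivity), one_div_div, add_comm μ, mul_comm σ]
  have hpayoff : (fun x : ℝ => max 0 (1 - LT / c * Real.exp (μ + σ * x)))
      = (Set.Iic d).indicator fun x => 1 - LT / c * Real.exp μ * Real.exp (σ * x) := by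
    ext x
    rw [Real.exp_add, ← mul_assoc]
    have hx' := hexercise x
    rw [Real.exp_add, ← mul_assoc] at hx'
    by_cases hx : x ≤ d
    · rw [Set.indicator_of_mem (Set.mem_Iic.2 hx), max_eq_right (sub_nonneg.2 (hx'.2 hx))]
    · rw [Set.indicator_of_notMem (by simpa using hx),
        max_eq_left (sub_nonpos.2 (not_le.1 (mt hx'.1 hx)).le)]
  have hlaw_integral : ∫ ω, max 0 (1 - LT / c * Real.exp (μ + σ * Z ω)) ∂P
      = ∫ x, max 0 (1 - LT / c * Real.exp (μ + σ * x)) ∂gaussianReal 0 1 := by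
    rw [← hlaw, integral_map hZ.aemeasurable (by fun_prop)]
  rw [integral_div, hlaw_integral, hpayoff, integral_indicator measurableSet_Iic,
    integral_sub (integrable_const _)
      ((integrable_exp_mul_gaussianReal σ).integrableOn.const_mul _),
    integral_const_mul, setIntegral_Iic_exp_mul_gaussianReal, setIntegral_const, hd',
    Real.exp_add, smul_eq_mul, mul_one, Measure.real, ← stdNormalCDF]
  ring
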